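/- arXiv:1806.07024 — 4 statements merged into one kernel-verified Lean document; each statement's English description precedes it below -/
import Mathlib

section
/- Let m and n be positive integers with gcd(m, φ(n)) = gcd(n, φ(m)) = 1, where φ is Euler's totient function. Then every finite group G that factorises as G = AB, where A is a cyclic subgroup of order m and B is a cyclic subgroup of order n, is abelian. -/
section Bicyclic

variable {G : Type*} [Group G]

theorem pow_conj_pow_eq {a b : G} {k : ℕ} (h : b⁻¹ * a * b = a ^ k) (j : ℕ) :
    (b ^ j)⁻¹ * a * b ^ j = a ^ k ^ j := by
  induction j with
  | zero => simp
  | succ j ih =>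
    calc (b ^ (j + 1))⁻¹ * a * b ^ (j + 1) = b⁻¹ * ((b ^ j)⁻¹ * a * b ^ j) * b := by
          rw [pow_succ]; group
      _ = (b⁻¹ * a * b) ^ k ^ j := by
          rw [ih]; simpa using (conj_pow (a := b⁻¹) (b := a) (i := k ^ j)).symm
      _ = a ^ k ^ (j + 1) := by rw [h, ← pow_mul, pow_succ']

/-- If `b` normalises `⟨a⟩` and its order is coprime to `φ(orderOf a)`, then it centralises `a`. -/
theorem commute_of_conj_mem_zpowers [Finite G] {a b : G}
    (h : b⁻¹ * a * b ∈ Subgroup.zpowers a)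
    (hco : Nat.Coprime (orderOf b) (Nat.totient (orderOf a))) : Commute a b := by
  rw [← mem_powers_iff_mem_zpowers] at h
  obtain ⟨k, hk⟩ := h
  have hk' : b⁻¹ * a * b = a ^ k := hk.symm
  have hpow : k ^ orderOf b ≡ 1 [MOD orderOf a] := by
    rw [← pow_eq_pow_iff_modEq, ← pow_conj_pow_eq hk', pow_orderOf_eq_one]
    simp
  have hz : (k : ZMod (orderOf a)) ^ orderOf b = 1 := by
    exact_mod_cast (ZMod.natCast_eq_natCast_iff _ _ _).2 hpow
  obtain ⟨u, hu⟩ : IsUnit (k : ZMod (orderOf a)) :=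
    IsUnit.of_pow_eq_one hz (orderOf_pos b).ne'
  have hu1 : u ^ orderOf b = 1 := by
    ext; push_cast; rw [hu, hz]
  have hone : u = 1 := by
    rw [← orderOf_eq_one_iff]
    exact Nat.eq_one_of_dvd_coprimes hco (orderOf_dvd_of_pow_eq_one hu1)
      (orderOf_dvd_of_pow_eq_one (ZMod.pow_totient u))
  have hk1 : k ≡ 1 [MOD orderOf a] := by
    rw [← ZMod.natCast_eq_natCast_iff, ← hu, hone]
    simp
  rw [← pow_eq_pow_iff_modEq, ← hk', pow_one] at hk1
  change a * b = b * a
  nth_rw 2 [← hk1]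
  group

/-- If `G = ⟨b⟩⟨a⟩` with `orderOf b ≤ orderOf a` and `b ∉ ⟨a⟩`, then `⟨a⟩` meets its conjugate
by `b` nontrivially. -/
theorem exists_ne_one_conj_mem_zpowers [Finite G] {a b : G}
    (hle : orderOf b ≤ orderOf a) (hba : b ∉ Subgroup.zpowers a)
    (hfact : ∀ g : G, ∃ i j : ℤ, g = b ^ i * a ^ j) :
    ∃ c ∈ Subgroup.zpowers a, c ≠ 1 ∧ b⁻¹ * c * b ∈ Subgroup.zpowers a := by
  by_contra! hcon
  have hcard : Nat.card (G ⧸ Subgroup.zpowers a) ≤ orderOf b := by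
    rw [← Nat.card_zpowers]
    refine Nat.card_le_card_of_surjective
      (fun x : Subgroup.zpowers b => ((x : G) : G ⧸ Subgroup.zpowers a)) fun q => ?_
    induction q using QuotientGroup.induction_on with
    | H g =>
      obtain ⟨i, j, rfl⟩ := hfact g
      refine ⟨⟨b ^ i, i, rfl⟩, QuotientGroup.eq.2 ?_⟩
      simp
  let f : Option (Subgroup.zpowers a) → G ⧸ Subgroup.zpowers a
    | none => ((1 : G) : G ⧸ Subgroup.zpowers a)
    | some x => ((x * b : G) : G ⧸ Subgroup.zpowers a)
  have hnone : ∀ x : Subgroup.zpowers a, f none ≠ f (some x) := fun x hx => by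
    have h := QuotientGroup.eq.1 hx
    rw [inv_one, one_mul] at h
    exact hba ((Subgroup.mul_mem_cancel_left _ x.2).1 h)
  have hf : Function.Injective f := by
    rintro (_ | x) (_ | y) hxy
    · rfl
    · exact (hnone y hxy).elim
    · exact (hnone x hxy.symm).elim
    · have h := QuotientGroup.eq.1 hxy
      by_contra hne
      refine hcon ((x : G)⁻¹ * y) (mul_mem (inv_mem x.2) y.2) (fun h1 => hne ?_) ?_
      · rw [Subtype.ext (inv_mul_eq_one.1 h1)]
      · simpa [mul_assoc] using h
  have := Nat.card_le_card_of_injective f hf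
  rw [Finite.card_option, Nat.card_zpowers] at this
  omega

theorem mem_zpowers_of_orderOf_eq [Finite G] {a x y : G} (hx : x ∈ Subgroup.zpowers a)
    (hy : y ∈ Subgroup.zpowers a) (h : orderOf x = orderOf y) : y ∈ Subgroup.zpowers x := by
  rw [← mem_powers_iff_mem_zpowers] at hx hy
  obtain ⟨k, rfl⟩ := hx
  obtain ⟨l, rfl⟩ := hy
  simp only at h ⊢
  have hgcd : (orderOf a).gcd k = (orderOf a).gcd l := by
    rw [orderOf_pow, orderOf_pow] at h
    exact (Nat.div_eq_iff_eq_of_dvd_dvd (orderOf_pos a).ne' (Nat.gcd_dvd_left _ _)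
      (Nat.gcd_dvd_left _ _)).1 h
  have hd : a ^ (orderOf a).gcd k ∈ Subgroup.zpowers (a ^ k) := by
    refine ⟨(orderOf a).gcdB k, ?_⟩
    simp only
    rw [← zpow_natCast a ((orderOf a).gcd k), Nat.gcd_eq_gcd_ab, zpow_add, zpow_mul, zpow_mul]
    simp [pow_orderOf_eq_one]
  obtain ⟨e, he⟩ : (orderOf a).gcd k ∣ l := hgcd ▸ Nat.gcd_dvd_right _ _
  rw [he, pow_mul]
  exact pow_mem hd e

/-- A subgroup of `⟨a⟩` that `b` conjugates into `⟨a⟩` is normal in `⟨a, b⟩`. -/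
theorem normal_zpowers_of_conj_mem [Finite G] {a b c : G} (hc : c ∈ Subgroup.zpowers a)
    (hcb : b⁻¹ * c * b ∈ Subgroup.zpowers a)
    (hfact : ∀ g : G, ∃ i j : ℤ, g = b ^ i * a ^ j) : (Subgroup.zpowers c).Normal := by
  have hord : orderOf c = orderOf (b⁻¹ * c * b) := by
    simpa using (orderOf_injective (MulAut.conj b⁻¹).toMonoidHom
      (MulAut.conj b⁻¹).injective c).symm
  have hmem := mem_zpowers_of_orderOf_eq hc hcb hord
  have hmem' : c ∈ Subgroup.zpowers (b⁻¹ * c * b) := mem_zpowers_of_orderOf_eq hcb hc hord.symm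
  have hb : b ∈ Subgroup.normalizer (Subgroup.zpowers c : Set G) := by
    refine Subgroup.mem_normalizer_iff''.2 fun h => ⟨?_, fun hh => ?_⟩
    · rintro ⟨i, rfl⟩
      have := zpow_mem hmem i
      rwa [show (b⁻¹ * c * b) ^ i = b⁻¹ * c ^ i * b by simpa using conj_zpow (a := b⁻¹) (b := c)]
        at this
    · obtain ⟨e, he⟩ := Subgroup.zpowers_le.2 hmem' hh
      refine ⟨e, ?_⟩
      have hconj : (b⁻¹ * c * b) ^ e = b⁻¹ * c ^ e * b := by
        simpa using conj_zpow (i := e) (a := b⁻¹) (b := c)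
      simp only [hconj] at he
      exact mul_left_cancel (mul_right_cancel he)
  have ha : a ∈ Subgroup.normalizer (Subgroup.zpowers c : Set G) := by
    obtain ⟨k, rfl⟩ := hc
    have hcomm : ∀ i : ℤ, a⁻¹ * ((a ^ k) ^ i) * a = (a ^ k) ^ i := fun i => by group
    refine Subgroup.mem_normalizer_iff''.2 fun h => ⟨?_, ?_⟩
    · rintro ⟨i, rfl⟩
      exact ⟨i, (hcomm i).symm⟩
    · rintro ⟨i, hi⟩
      refine ⟨i, mul_left_cancel (a := a⁻¹) (mul_right_cancel (b := a) ?_)⟩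
      exact (hcomm i).trans hi
  refine Subgroup.normalizer_eq_top_iff.1 (eq_top_iff.2 fun g _ => ?_)
  obtain ⟨i, j, rfl⟩ := hfact g
  exact mul_mem (zpow_mem hb i) (zpow_mem ha j)

theorem conj_mem_zpowers_of_quotient {a b : G} (N : Subgroup G) [N.Normal]
    (hN : N ≤ Subgroup.zpowers a) (h : Commute (a : G ⧸ N) (b : G ⧸ N)) :
    b⁻¹ * a * b ∈ Subgroup.zpowers a := by
  have h' : ((b * a : G) : G ⧸ N) = ((a * b : G) : G ⧸ N) := h.symm
  have h2 := hN (QuotientGroup.eq.1 h')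
  have h3 := mul_mem (Subgroup.mem_zpowers a) h2
  convert h3 using 1
  group

/-- The induction step when `orderOf b ≤ orderOf a`: commutativity of the images of `a` and `b` in
proper quotients forces `a` and `b` to commute. -/
theorem commute_of_orderOf_le [Finite G] {a b : G} (hle : orderOf b ≤ orderOf a)
    (hco : Nat.Coprime (orderOf b) (Nat.totient (orderOf a)))
    (hfact : ∀ g : G, ∃ i j : ℤ, g = b ^ i * a ^ j)
    (ih : ∀ (N : Subgroup G) [N.Normal], N ≠ ⊥ → Commute (a : G ⧸ N) (b : G ⧸ N)) :
    Commute a b := by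
  by_cases hba : b ∈ Subgroup.zpowers a
  · obtain ⟨k, rfl⟩ := hba
    exact Commute.self_zpow a k
  obtain ⟨c, hc, hc1, hcb⟩ := exists_ne_one_conj_mem_zpowers hle hba hfact
  have := normal_zpowers_of_conj_mem hc hcb hfact
  exact commute_of_conj_mem_zpowers (conj_mem_zpowers_of_quotient (Subgroup.zpowers c)
    (Subgroup.zpowers_le.2 hc) (ih _ (Subgroup.zpowers_ne_bot.2 hc1))) hco

theorem exists_zpow_mul_zpow_swap {a b : G} (h : ∀ g : G, ∃ i j : ℤ, g = a ^ i * b ^ j) (g : G) :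
    ∃ i j : ℤ, g = b ^ i * a ^ j := by
  obtain ⟨i, j, hg⟩ := h g⁻¹
  refine ⟨-j, -i, ?_⟩
  rw [← inv_inv g, hg]
  simp

theorem commute_of_coprime_totient.{u} (N : ℕ) : ∀ (G : Type u) [Group G] [Finite G] (a b : G),
    Nat.card G ≤ N → Nat.Coprime (orderOf a) (Nat.totient (orderOf b)) →
    Nat.Coprime (orderOf b) (Nat.totient (orderOf a)) →
    (∀ g : G, ∃ i j : ℤ, g = a ^ i * b ^ j) → Commute a b := by
  induction N with
  | zero =>
    intro G _ _ a b hN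
    exact absurd hN Nat.card_pos.not_ge
  | succ N ih =>
    intro G _ _ a b hN hab hba hfact
    have hq : ∀ (K : Subgroup G) [K.Normal], K ≠ ⊥ → Commute (a : G ⧸ K) (b : G ⧸ K) := by
      intro K _ hK
      have hda : orderOf (a : G ⧸ K) ∣ orderOf a := orderOf_map_dvd (QuotientGroup.mk' K) a
      have hdb : orderOf (b : G ⧸ K) ∣ orderOf b := orderOf_map_dvd (QuotientGroup.mk' K) b
      refine ih (G ⧸ K) a b ?_ ?_ ?_ ?_
      · have h1 := Subgroup.card_eq_card_quotient_mul_card_subgroup K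
        have h2 := (Subgroup.one_lt_card_iff_ne_bot K).2 hK
        have h3 : 0 < Nat.card (G ⧸ K) := Nat.card_pos
        nlinarith
      · exact (hab.coprime_dvd_left hda).coprime_dvd_right (Nat.totient_dvd_of_dvd hdb)
      · exact (hba.coprime_dvd_left hdb).coprime_dvd_right (Nat.totient_dvd_of_dvd hda)
      · intro q
        induction q using QuotientGroup.induction_on with
        | H g =>
          obtain ⟨i, j, rfl⟩ := hfact g
          exact ⟨i, j, rfl⟩
    rcases le_total (orderOf b) (orderOf a) with hle | hle
    · exact commute_of_orderOf_le hle hba (exists_zpow_mul_zpow_swap hfact) hq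
    · exact (commute_of_orderOf_le hle hab hfact fun K _ hK => (hq K hK).symm).symm

end Bicyclic


/-- If `gcd(m, φ(n)) = gcd(n, φ(m)) = 1`, then every finite group that factorises as a
product of a cyclic subgroup of order `m` and a cyclic subgroup of order `n` is abelian. -/
theorem singular_pair_bicyclic_abelian (m n : ℕ) (hm : 0 < m) (hn : 0 < n)
    (h1 : Nat.gcd m (Nat.totient n) = 1) (h2 : Nat.gcd n (Nat.totient m) = 1)
    (G : Type*) [Group G] [Finite G] (a b : G)
    (ha : orderOf a = m) (hb : orderOf b = n)
    (hfact : ∀ g : G, ∃ i j : ℤ, g = a ^ i * b ^ j) :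
    ∀ x y : G, x * y = y * x := by
  subst ha hb
  have hab := commute_of_coprime_totient _ G a b le_rfl h1 h2 hfact
  intro x y
  obtain ⟨i, j, rfl⟩ := hfact x
  obtain ⟨k, l, rfl⟩ := hfact y
  exact (((Commute.refl a).zpow_zpow i k).mul_right (hab.zpow_zpow i l)).mul_left
    ((hab.symm.zpow_zpow j k).mul_right ((Commute.refl b).zpow_zpow j l))
end

section
/- Let m and n be positive integers with gcd(m, φ(n)) = gcd(n, φ(m)) = 1. Then every finite group G that factorises as G = AB with A cyclic of order m, B cyclic of order n, and A ∩ B = 1 is isomorphic to ℤ_m × ℤ_n. -/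
/-- In a finite group, `a ^ i` lies in the subgroup generated by `a ^ j` as soon as the two powers
have the same order. -/
lemma pow_mem_zpowers_pow_of_orderOf_eq {G : Type*} [Group G] [Finite G] (a : G) (i j : ℕ)
    (h : orderOf (a ^ i) = orderOf (a ^ j)) : a ^ i ∈ Subgroup.zpowers (a ^ j) := by
  have hgcd : (orderOf a).gcd i = (orderOf a).gcd j := by
    rw [orderOf_pow, orderOf_pow] at h
    have e1 := Nat.div_mul_cancel (Nat.gcd_dvd_left (orderOf a) i)
    have e2 := Nat.div_mul_cancel (Nat.gcd_dvd_left (orderOf a) j)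
    have hpos : 0 < orderOf a / (orderOf a).gcd j :=
      Nat.div_pos (Nat.gcd_le_left _ (orderOf_pos a)) (Nat.gcd_pos_of_pos_left _ (orderOf_pos a))
    rw [h, ← e2] at e1
    exact Nat.eq_of_mul_eq_mul_left hpos (by simpa [e2] using e1)
  have hmem : a ^ (orderOf a).gcd j ∈ Subgroup.zpowers (a ^ j) := by
    refine ⟨(orderOf a).gcdB j, ?_⟩
    have hb := Nat.gcd_eq_gcd_ab (orderOf a) j
    change (a ^ j) ^ (orderOf a).gcdB j = _
    rw [← zpow_natCast a ((orderOf a).gcd j), hb, zpow_add, zpow_mul, zpow_mul, zpow_natCast,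
      pow_orderOf_eq_one, one_zpow, one_mul, zpow_natCast]
  obtain ⟨k, hk⟩ : (orderOf a).gcd j ∣ i := hgcd ▸ Nat.gcd_dvd_right _ _
  rw [hk, pow_mul]
  exact Subgroup.pow_mem _ hmem k

/-- If `G = ⟨a⟩⟨b⟩` is finite, then a cyclic subgroup `⟨x⟩` such that conjugation by `a` and by `b`
maps `x` into `⟨x⟩` is normal. -/
lemma normal_zpowers_of_factorization {G : Type*} [Group G] [Finite G] {a b x : G}
    (hfact : ∀ g : G, ∃ i j : ℤ, g = a ^ i * b ^ j)
    (ha : a * x * a⁻¹ ∈ Subgroup.zpowers x) (hb : b * x * b⁻¹ ∈ Subgroup.zpowers x) :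
    (Subgroup.zpowers x).Normal := by
  have key (g : G) (hg : g * x * g⁻¹ ∈ Subgroup.zpowers x) :
      g ∈ Subgroup.normalizer (Subgroup.zpowers x : Set G) := by
    refine Subgroup.mem_normalizer_fintype ?_
    rintro _ ⟨k, rfl⟩
    simp only [SetLike.mem_coe]
    rw [← conj_zpow]
    exact zpow_mem hg k
  rw [← Subgroup.normalizer_eq_top_iff, eq_top_iff]
  rintro g -
  obtain ⟨i, j, rfl⟩ := hfact g
  exact mul_mem (zpow_mem (key a ha) i) (zpow_mem (key b hb) j)

/-- In an exact product `G = ⟨a⟩⟨b⟩` with `orderOf b ≤ orderOf a` and `b ≠ 1`, the subgroup `⟨a⟩`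
contains a nontrivial normal subgroup of `G`. -/
lemma exists_normal_zpowers_of_exact_factorization {G : Type*} [Group G] [Finite G] {a b : G}
    (hfact : ∀ g : G, ∃ i j : ℤ, g = a ^ i * b ^ j)
    (hint : Subgroup.zpowers a ⊓ Subgroup.zpowers b = ⊥)
    (hle : orderOf b ≤ orderOf a) (hb : b ≠ 1) :
    ∃ x ∈ Subgroup.zpowers a, x ≠ 1 ∧ (Subgroup.zpowers x).Normal := by
  obtain ⟨x, hx, hx1, hxb⟩ : ∃ x ∈ Subgroup.zpowers a, x ≠ 1 ∧
      b * x * b⁻¹ ∈ Subgroup.zpowers a := by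
    by_contra! hcon
    let f : Subgroup.zpowers a × Subgroup.zpowers a → G := fun p ↦ p.1 * (b * p.2 * b⁻¹)
    have hinj : Function.Injective f := by
      rintro ⟨x, y⟩ ⟨x', y'⟩ h
      simp only [f] at h
      have hy : (y : G) * (y' : G)⁻¹ = 1 := by
        by_contra hne
        refine hcon _ (mul_mem y.2 (inv_mem y'.2)) hne ?_
        have : b * ((y : G) * (y' : G)⁻¹) * b⁻¹ = (x : G)⁻¹ * x' := by
          calc b * ((y : G) * (y' : G)⁻¹) * b⁻¹
              = (x : G)⁻¹ * (x * (b * y * b⁻¹)) * (b * y' * b⁻¹)⁻¹ := by group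
            _ = (x : G)⁻¹ * x' := by rw [h]; group
        rw [this]
        exact mul_mem (inv_mem x.2) x'.2
      have hy' : (y : G) = y' := mul_inv_eq_one.mp hy
      rw [hy'] at h
      have hx' : (x : G) = x' := mul_right_cancel h
      ext <;> assumption
    have hcard : Nat.card G ≤ Nat.card (Subgroup.zpowers a × Subgroup.zpowers a) := by
      have hsurj : Function.Surjective
          (fun p : Subgroup.zpowers a × Subgroup.zpowers b ↦ (p.1 : G) * p.2) := by
        intro g
        obtain ⟨i, j, rfl⟩ := hfact g
        exact ⟨(⟨a ^ i, i, rfl⟩, ⟨b ^ j, j, rfl⟩), rfl⟩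
      refine (Nat.card_le_card_of_surjective _ hsurj).trans ?_
      rw [Nat.card_prod, Nat.card_prod, Nat.card_zpowers, Nat.card_zpowers]
      exact Nat.mul_le_mul_left _ hle
    obtain ⟨⟨x, y⟩, hxy⟩ := (hinj.bijective_of_nat_card_le hcard).2 b⁻¹
    have hba : b ∈ Subgroup.zpowers a := by
      have : b = (x : G)⁻¹ * (y : G)⁻¹ := by
        simp only [f] at hxy
        have h1 : (x : G) * b * y = 1 := by
          calc (x : G) * b * y = x * (b * y * b⁻¹) * b := by group
            _ = 1 := by rw [hxy]; group
        calc b = (x : G)⁻¹ * (x * b * y) * (y : G)⁻¹ := by group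
          _ = _ := by rw [h1]; group
      rw [this]
      exact mul_mem (inv_mem x.2) (inv_mem y.2)
    have : b ∈ Subgroup.zpowers a ⊓ Subgroup.zpowers b := ⟨hba, Subgroup.mem_zpowers b⟩
    rw [hint] at this
    exact hb (Subgroup.mem_bot.mp this)
  refine ⟨x, hx, hx1, normal_zpowers_of_factorization hfact ?_ ?_⟩
  · obtain ⟨k, rfl⟩ := hx
    simp only
    rw [((Commute.refl a).zpow_right k).eq, mul_inv_cancel_right]
    exact Subgroup.mem_zpowers _
  · obtain ⟨j, rfl⟩ := mem_powers_iff_mem_zpowers.mpr hx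
    obtain ⟨i, hi⟩ := mem_powers_iff_mem_zpowers.mpr hxb
    simp only at hi ⊢
    rw [← hi]
    refine pow_mem_zpowers_pow_of_orderOf_eq a i j ?_
    rw [hi]
    exact orderOf_injective (MulAut.conj b).toMonoidHom (MulAut.conj b).injective (a ^ j)

/-- An element normalising a cyclic subgroup `⟨x⟩` centralises it if its order is coprime to
`φ (orderOf x)`. -/
lemma commute_of_normal_zpowers_of_coprime {G : Type*} [Group G] [Finite G] {x b : G}
    (hN : (Subgroup.zpowers x).Normal)
    (h : (orderOf b).Coprime (Nat.totient (orderOf x))) : Commute b x := by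
  have h1 : orderOf (MulAut.conjNormal (H := Subgroup.zpowers x) b) ∣ orderOf b :=
    orderOf_map_dvd _ b
  have h2 : orderOf (MulAut.conjNormal (H := Subgroup.zpowers x) b) ∣
      Nat.totient (orderOf x) := by
    have := orderOf_dvd_natCard (MulAut.conjNormal (H := Subgroup.zpowers x) b)
    rwa [IsCyclic.card_mulAut, Nat.card_zpowers] at this
  have h3 := orderOf_eq_one_iff.mp (Nat.eq_one_of_dvd_coprimes h h1 h2)
  have h4 := MulAut.conjNormal_apply (H := Subgroup.zpowers x) b ⟨x, Subgroup.mem_zpowers x⟩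
  rw [h3] at h4
  exact mul_inv_eq_iff_eq_mul.mp h4.symm

/-- If `b * a * b⁻¹ = z * a` with `z` a power of `a` commuting with `b`, and the order of `b` is
coprime to `φ (orderOf a)`, then `a` and `b` commute. -/
lemma commute_of_conj_eq_central_mul {G : Type*} [Group G] [Finite G] {a b z : G}
    (h : (orderOf b).Coprime (Nat.totient (orderOf a)))
    (hz : z ∈ Subgroup.zpowers a) (hzb : Commute b z)
    (hba : b * a * b⁻¹ = z * a) : Commute a b := by
  have hza : Commute z a := by
    obtain ⟨k, rfl⟩ := hz
    exact (Commute.refl a).zpow_left k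
  have hpow (i : ℕ) : b * a ^ i * b⁻¹ = z ^ i * a ^ i := by
    rw [← conj_pow, hba, hza.mul_pow]
  have hm : orderOf z ∣ orderOf a := by
    rw [orderOf_dvd_iff_pow_eq_one]
    simpa [pow_orderOf_eq_one] using (hpow (orderOf a)).symm
  have hn : orderOf z ∣ orderOf b := by
    rw [orderOf_dvd_iff_pow_eq_one]
    have e : a⁻¹ * b * a = z * b := by
      have h' : b * a = z * a * b := mul_inv_eq_iff_eq_mul.mp hba
      rw [mul_assoc, h', hza.eq]; group
    have e' := conj_pow (a := a⁻¹) (b := b) (i := orderOf b)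
    rw [inv_inv, e, hzb.symm.mul_pow, pow_orderOf_eq_one] at e'
    simpa using e'
  have hz1 : orderOf z = 1 := by
    by_contra hne
    obtain ⟨p, hp, hpz⟩ := Nat.exists_prime_and_dvd hne
    obtain ⟨m', hm'⟩ := hpz.trans hm
    have hpm' : ¬ p ∣ m' := by
      rintro ⟨r, rfl⟩
      have hpp : p ∣ Nat.totient (orderOf a) := by
        refine dvd_trans ?_ (Nat.totient_dvd_of_dvd (a := p * p) (b := orderOf a) ⟨r, ?_⟩)
        · rw [Nat.totient_mul_of_prime_of_dvd hp dvd_rfl]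
          exact dvd_mul_right _ _
        · rw [hm', mul_assoc]
      exact hp.one_lt.ne' (Nat.eq_one_of_dvd_coprimes h (hpz.trans hn) hpp)
    obtain ⟨r, hr⟩ := hpz
    have hrpos : 0 < r := Nat.pos_of_ne_zero fun h0 ↦ (orderOf_pos z).ne' (by rw [hr, h0, mul_zero])
    obtain ⟨l, hl⟩ := mem_powers_iff_mem_zpowers.mpr (Subgroup.pow_mem _ hz r)
    simp only at hl
    have hml : m' ∣ l := by
      have : orderOf a ∣ p * l := by
        rw [orderOf_dvd_iff_pow_eq_one, mul_comm, pow_mul, hl, ← pow_mul, mul_comm, ← hr,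
          pow_orderOf_eq_one]
      rw [hm'] at this
      exact Nat.dvd_of_mul_dvd_mul_left hp.pos this
    have hzl : z ^ l = 1 := by
      have e := hpow l
      rw [hl, (hzb.pow_right r).eq, mul_inv_cancel_right] at e
      simpa using e.symm
    have hpl : p ∣ l := (Dvd.intro r hr.symm).trans (orderOf_dvd_of_pow_eq_one hzl)
    have hal : orderOf a ∣ l := by
      rw [hm']
      exact ((Nat.Prime.coprime_iff_not_dvd hp).mpr hpm').mul_dvd_of_dvd_of_dvd hpl hml
    have hzr : z ^ r = 1 := by rw [← hl, orderOf_dvd_iff_pow_eq_one.mp hal]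
    have := Nat.le_of_dvd hrpos (orderOf_dvd_of_pow_eq_one hzr)
    rw [hr] at this
    nlinarith [hp.two_le]
  rw [orderOf_eq_one_iff.mp hz1, one_mul] at hba
  exact (mul_inv_eq_iff_eq_mul.mp hba).symm

/-- In an exact product of cyclic subgroups `⟨a⟩` and `⟨b⟩` whose orders form a singular pair,
the generators commute. -/
theorem commute_of_exact_factorization_of_coprime_totient {G : Type*} [Group G] [Finite G]
    {a b : G} (h1 : (orderOf a).Coprime (Nat.totient (orderOf b)))
    (h2 : (orderOf b).Coprime (Nat.totient (orderOf a)))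
    (hfact : ∀ g : G, ∃ i j : ℤ, g = a ^ i * b ^ j)
    (hint : Subgroup.zpowers a ⊓ Subgroup.zpowers b = ⊥) : Commute a b := by
  induction hk : Nat.card G using Nat.strong_induction_on generalizing G with
  | _ k ih =>
  subst hk
  wlog hle : orderOf b ≤ orderOf a generalizing a b
  · refine (this h2 h1 (fun g ↦ ?_) (by rwa [inf_comm]) (not_le.mp hle).le).symm
    obtain ⟨i, j, h⟩ := hfact g⁻¹
    exact ⟨-j, -i, by rw [← inv_inv g, h]; simp⟩
  rcases eq_or_ne b 1 with rfl | hb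
  · exact Commute.one_right a
  obtain ⟨x, hx, hx1, hN⟩ := exists_normal_zpowers_of_exact_factorization hfact hint hle hb
  have hxa : Subgroup.zpowers x ≤ Subgroup.zpowers a := Subgroup.zpowers_le.mpr hx
  have hbx : Commute b x := commute_of_normal_zpowers_of_coprime hN <|
    h2.coprime_dvd_right (Nat.totient_dvd_of_dvd (orderOf_dvd_of_mem_zpowers hx))
  let q := QuotientGroup.mk' (Subgroup.zpowers x)
  have hda : orderOf (q a) ∣ orderOf a := orderOf_map_dvd q a
  have hdb : orderOf (q b) ∣ orderOf b := orderOf_map_dvd q b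
  have hcard : Nat.card (G ⧸ Subgroup.zpowers x) < Nat.card G := by
    rw [Subgroup.card_eq_card_quotient_mul_card_subgroup (Subgroup.zpowers x), Nat.card_zpowers]
    have := orderOf_pos x
    have : orderOf x ≠ 1 := fun h ↦ hx1 (orderOf_eq_one_iff.mp h)
    exact lt_mul_of_one_lt_right Nat.card_pos (by omega)
  have hq : Commute (q a) (q b) := by
    refine ih _ hcard
      ((h1.coprime_dvd_left hda).coprime_dvd_right (Nat.totient_dvd_of_dvd hdb))
      ((h2.coprime_dvd_left hdb).coprime_dvd_right (Nat.totient_dvd_of_dvd hda)) ?_ ?_ rfl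
    · intro g
      obtain ⟨g, rfl⟩ := QuotientGroup.mk'_surjective _ g
      obtain ⟨i, j, rfl⟩ := hfact g
      exact ⟨i, j, by simp [q]⟩
    · rw [eq_bot_iff]
      rintro _ ⟨⟨i, rfl⟩, ⟨j, hj⟩⟩
      simp only at hj ⊢
      rw [← map_zpow, ← map_zpow] at hj
      have hmem : (b ^ j)⁻¹ * a ^ i ∈ Subgroup.zpowers x := QuotientGroup.eq.mp hj
      have hbj : b ^ j ∈ Subgroup.zpowers a := by
        have := mul_mem (Subgroup.zpow_mem_zpowers a i) (inv_mem (hxa hmem))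
        simpa using this
      have hbj' : b ^ j ∈ Subgroup.zpowers a ⊓ Subgroup.zpowers b :=
        ⟨hbj, Subgroup.zpow_mem_zpowers b j⟩
      rw [hint, Subgroup.mem_bot] at hbj'
      rw [Subgroup.mem_bot, ← map_zpow, ← hj, hbj', map_one]
  have hz : b * a * b⁻¹ * a⁻¹ ∈ Subgroup.zpowers x := by
    rw [← QuotientGroup.eq_one_iff]
    change q (b * a * b⁻¹ * a⁻¹) = 1
    simp only [map_mul, map_inv]
    rw [← hq.eq]
    group
  refine commute_of_conj_eq_central_mul h2 (hxa hz) ?_ (by group)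
  obtain ⟨k, hk⟩ := hz
  rw [← hk]
  exact hbx.zpow_right k

/-- If `gcd(m, φ(n)) = gcd(n, φ(m)) = 1`, then every finite group that factorises as an
exact product of cyclic subgroups of orders `m` and `n` is isomorphic to
`ℤ_m × ℤ_n`. -/
theorem singular_pair_exact_bicyclic_iso (m n : ℕ) (hm : 0 < m) (hn : 0 < n)
    (h1 : Nat.gcd m (Nat.totient n) = 1) (h2 : Nat.gcd n (Nat.totient m) = 1)
    (G : Type*) [Group G] [Finite G] (a b : G)
    (ha : orderOf a = m) (hb : orderOf b = n)
    (hfact : ∀ g : G, ∃ i j : ℤ, g = a ^ i * b ^ j)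
    (hint : Subgroup.zpowers a ⊓ Subgroup.zpowers b = ⊥) :
    Nonempty (G ≃* Multiplicative (ZMod m) × Multiplicative (ZMod n)) := by
  subst ha hb
  have hab := commute_of_exact_factorization_of_coprime_totient h1 h2 hfact hint
  have hcomm (x : Subgroup.zpowers a) (y : Subgroup.zpowers b) :
      Commute ((Subgroup.zpowers a).subtype x) ((Subgroup.zpowers b).subtype y) := by
    obtain ⟨_, i, rfl⟩ := x
    obtain ⟨_, j, rfl⟩ := y
    exact hab.zpow_zpow i j
  have hbij : Function.Bijective (MonoidHom.noncommCoprod _ _ hcomm) := by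
    constructor
    · rw [MonoidHom.noncommCoprod_injective]
      refine ⟨Subtype.val_injective, Subtype.val_injective, ?_⟩
      rw [Subgroup.range_subtype, Subgroup.range_subtype, disjoint_iff]
      exact hint
    · intro g
      obtain ⟨i, j, rfl⟩ := hfact g
      exact ⟨(⟨a ^ i, i, rfl⟩, ⟨b ^ j, j, rfl⟩), rfl⟩
  have e (c : G) : Subgroup.zpowers c ≃* Multiplicative (ZMod (orderOf c)) :=
    mulEquivOfCyclicCardEq ((Nat.card_zpowers c).trans (Nat.card_zmod _).symm)
  exact ⟨(MulEquiv.ofBijective _ hbij).symm.trans ((e a).prodCongr (e b))⟩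
end

section
/- Let n be a positive integer with gcd(n, φ(n)) = 1. Then every finite group factorisable as a product of two cyclic subgroups, each of order n, is abelian. -/
open scoped commutatorElement

theorem card_dvd_mul_card_of_factorization {G : Type*} [Group G] [Finite G] (A B : Subgroup G)
    (hAB : ∀ g : G, ∃ x ∈ A, ∃ y ∈ B, g = x * y) :
    Nat.card G ∣ Nat.card A * Nat.card B := by
  have horbit : MulAction.orbit A ((1 : G) : G ⧸ B) = Set.univ := by
    refine Set.eq_univ_of_forall fun q => ?_
    induction q using QuotientGroup.induction_on with
    | H g =>
      obtain ⟨x, hx, y, hy, rfl⟩ := hAB g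
      refine ⟨⟨x, hx⟩, ?_⟩
      change ((x * 1 : G) : G ⧸ B) = _
      rw [QuotientGroup.eq]
      simpa using hy
  have hindex := MulAction.index_stabilizer A ((1 : G) : G ⧸ B)
  rw [horbit, Set.ncard_univ] at hindex
  have hdvd : B.index ∣ Nat.card A := by
    rw [Subgroup.index, ← hindex]
    exact Subgroup.index_dvd_card _
  rw [← B.index_mul_card]
  exact mul_dvd_mul_right hdvd _

/-- In a product `G = AB` of two abelian subgroups, the subgroup generated by the commutators
`⁅x, y⁆` with `x ∈ A`, `y ∈ B` is normal and abelian (Itô). -/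
theorem exists_normal_abelian_of_factorization {G : Type*} [Group G] (A B : Subgroup G)
    (hA : ∀ x ∈ A, ∀ y ∈ A, x * y = y * x) (hB : ∀ x ∈ B, ∀ y ∈ B, x * y = y * x)
    (hAB : ∀ g : G, ∃ x ∈ A, ∃ y ∈ B, g = x * y) :
    ∃ M : Subgroup G, M.Normal ∧ (∀ x ∈ M, ∀ y ∈ M, x * y = y * x) ∧
      ∀ x ∈ A, ∀ y ∈ B, ⁅x, y⁆ ∈ M := by
  have conj_left : ∀ b ∈ B, ∀ a₁ ∈ A, ∃ b₂ ∈ B, ∀ a ∈ A, a₁ * ⁅a, b⁆ * a₁⁻¹ = ⁅a, b₂⁆ := by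
    intro b hb a₁ ha₁
    obtain ⟨x, hx, y, hy, hxy⟩ := hAB (a₁ * b * a₁⁻¹)⁻¹
    refine ⟨y⁻¹, inv_mem hy, fun a ha => ?_⟩
    have e : a₁ * b * a₁⁻¹ = y⁻¹ * x⁻¹ := by rw [← mul_inv_rev, ← hxy, inv_inv]
    have c₁ : Commute a a₁ := hA a ha a₁ ha₁
    have c₂ : Commute a x := hA a ha x hx
    calc a₁ * ⁅a, b⁆ * a₁⁻¹ = ⁅a₁ * a * a₁⁻¹, a₁ * b * a₁⁻¹⁆ :=
          conjugate_commutatorElement _ _ _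
      _ = ⁅a, y⁻¹ * x⁻¹⁆ := by rw [← c₁.eq, mul_inv_cancel_right, e]
      _ = a * y⁻¹ * (x⁻¹ * a⁻¹ * x) * y := by simp only [commutatorElement_def]; group
      _ = ⁅a, y⁻¹⁆ := by
          rw [mul_assoc x⁻¹, c₂.inv_left.eq, inv_mul_cancel_left, commutatorElement_def, inv_inv]
  have conj_right : ∀ a ∈ A, ∀ b₁ ∈ B, ∃ a₃ ∈ A, ∀ b ∈ B, b₁ * ⁅a, b⁆ * b₁⁻¹ = ⁅a₃, b⁆ := by
    intro a ha b₁ hb₁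
    obtain ⟨x, hx, y, hy, hxy⟩ := hAB (b₁ * a * b₁⁻¹)
    refine ⟨x, hx, fun b hb => ?_⟩
    have c₁ : Commute b b₁ := hB b hb b₁ hb₁
    have c₂ : Commute b y := hB b hb y hy
    calc b₁ * ⁅a, b⁆ * b₁⁻¹ = ⁅b₁ * a * b₁⁻¹, b₁ * b * b₁⁻¹⁆ :=
          conjugate_commutatorElement _ _ _
      _ = ⁅x * y, b⁆ := by rw [← c₁.eq, mul_inv_cancel_right, hxy]
      _ = x * (y * b * y⁻¹) * x⁻¹ * b⁻¹ := by simp only [commutatorElement_def]; group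
      _ = ⁅x, b⁆ := by rw [← c₂.eq, mul_inv_cancel_right, commutatorElement_def]
  let S : Set G := {z | ∃ x ∈ A, ∃ y ∈ B, z = ⁅x, y⁆}
  have comm : ∀ u ∈ S, ∀ v ∈ S, u * v = v * u := by
    rintro _ ⟨a, ha, b, hb, rfl⟩ _ ⟨a₁, ha₁, b₁, hb₁, rfl⟩
    obtain ⟨b₂, hb₂, h₂⟩ := conj_left b hb a₁⁻¹ (inv_mem ha₁)
    obtain ⟨a₃, ha₃, h₃⟩ := conj_right a ha b₁⁻¹ (inv_mem hb₁)
    have e₁ : b₁⁻¹ * (a₁⁻¹ * ⁅a, b⁆ * a₁⁻¹⁻¹) * b₁⁻¹⁻¹ = ⁅a₃, b₂⁆ := by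
      rw [h₂ a ha, h₃ b₂ hb₂]
    have e₂ : a₁⁻¹ * (b₁⁻¹ * ⁅a, b⁆ * b₁⁻¹⁻¹) * a₁⁻¹⁻¹ = ⁅a₃, b₂⁆ := by
      rw [h₃ b hb, h₂ a₃ ha₃]
    generalize ⁅a, b⁆ = u at e₁ e₂
    have e₃ := e₁.trans e₂.symm
    calc u * ⁅a₁, b₁⁆ = a₁ * b₁ * (b₁⁻¹ * (a₁⁻¹ * u * a₁⁻¹⁻¹) * b₁⁻¹⁻¹) * a₁⁻¹ * b₁⁻¹ := by
          simp only [commutatorElement_def]; group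
      _ = ⁅a₁, b₁⁆ * u := by rw [e₃]; simp only [commutatorElement_def]; group
  have conj_mem : ∀ u ∈ S, ∀ g : G, g * u * g⁻¹ ∈ S := by
    rintro _ ⟨a, ha, b, hb, rfl⟩ g
    obtain ⟨x, hx, y, hy, rfl⟩ := hAB g
    obtain ⟨a₃, ha₃, h₃⟩ := conj_right a ha y hy
    obtain ⟨b₂, hb₂, h₂⟩ := conj_left b hb x hx
    refine ⟨a₃, ha₃, b₂, hb₂, ?_⟩
    rw [← h₂ a₃ ha₃, ← h₃ b hb]
    group
  refine ⟨Subgroup.closure S, ⟨fun u hu g => ?_⟩, fun x hx y hy => ?_,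
    fun x hx y hy => Subgroup.subset_closure ⟨x, hx, y, hy, rfl⟩⟩
  · have hle : Subgroup.closure S ≤ (Subgroup.closure S).comap (MulAut.conj g).toMonoidHom :=
      (Subgroup.closure_le _).2 fun v hv => Subgroup.subset_closure (conj_mem v hv g)
    exact hle hu
  · have := Subgroup.isMulCommutative_closure comm
    exact setLike_mul_comm hx hy

/-- An automorphism `β` of a group of order `q ^ k`, `k ≤ 2`, whose `r`-th power is trivial for a
prime `r` not dividing `q - 1`, is trivial as soon as it has a nontrivial fixed point when
`k = 2`. -/
theorem mulAut_eq_one_of_pow_eq_one {Q : Type*} [Group Q] [Finite Q] {q r k : ℕ} (hq : q.Prime)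
    (hr : r.Prime) (hcard : Nat.card Q = q ^ k) (hk : k ≤ 2) (hrq : ¬ r ∣ q - 1) (β : MulAut Q)
    (hβ : β ^ r = 1) (hr_eq : r = q → k ≤ 1) (hfix : k = 2 → ∃ x : Q, x ≠ 1 ∧ β x = x) :
    β = 1 := by
  classical
  have := Fintype.ofFinite Q
  have := Fact.mk hr
  let F : Subgroup Q := MonoidHom.eqLocus β.toMonoidHom (MonoidHom.id Q)
  have memF : ∀ x, x ∈ F ↔ β x = x := fun x => Iff.rfl
  have hmod : Nat.card Q ≡ Nat.card F [MOD r] := by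
    let f : Function.End Q := fun x => β x
    have hpow : ∀ m : ℕ, ∀ x, (f ^ m) x = (β ^ m) x := by
      intro m
      induction m with
      | zero => intro x; rfl
      | succ m ih =>
        intro x
        rw [pow_succ, pow_succ]
        exact ih (β x)
    have hf : f ^ r ^ 1 = 1 := by
      funext x
      rw [pow_one, hpow, hβ]
      rfl
    have := Equiv.Perm.card_fixedPoints_modEq hf
    rw [← Nat.card_eq_fintype_card, ← Nat.card_eq_fintype_card] at this
    exact this
  obtain ⟨j, hj, hFj⟩ := (Nat.dvd_prime_pow hq).1 (hcard ▸ F.card_subgroup_dvd_card)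
  have hFtop : F = ⊤ := by
    apply Subgroup.eq_top_of_card_eq
    rw [hFj, hcard]
    by_contra hne
    have hjk : j < k := lt_of_le_of_ne hj fun e => hne (e ▸ rfl)
    rw [hFj, hcard] at hmod
    have hdvd : r ∣ q ^ k - q ^ j :=
      (Nat.modEq_iff_dvd' (Nat.pow_le_pow_right hq.pos hjk.le)).1 hmod.symm
    rcases (show j = 0 ∧ k = 1 ∨ k = 2 ∧ j = 0 ∨ k = 2 ∧ j = 1 by omega) with
      ⟨rfl, rfl⟩ | ⟨rfl, rfl⟩ | ⟨rfl, rfl⟩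
    · exact hrq (by simpa using hdvd)
    · obtain ⟨x, hx, hfx⟩ := hfix rfl
      have hbot : F = ⊥ := Subgroup.card_eq_one.1 (by simpa using hFj)
      exact hx (by simpa [hbot] using (memF x).2 hfx)
    · have e : q ^ 2 - q ^ 1 = q * (q - 1) := by rw [Nat.mul_sub, pow_two, pow_one, mul_one]
      rw [e] at hdvd
      rcases hr.dvd_mul.1 hdvd with hd | hd
      · have := hr_eq ((Nat.prime_dvd_prime_iff_eq hr hq).1 hd)
        omega
      · exact hrq hd
  ext x
  exact (memF x).1 (hFtop ▸ Subgroup.mem_top x)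

theorem squarefree_of_coprime_totient {n : ℕ} (h : Nat.gcd n n.totient = 1) :
    Squarefree n := by
  rw [Nat.squarefree_iff_prime_squarefree]
  intro q hq hqq
  have hdvd : q ∣ n.totient := by
    refine dvd_trans ?_ (Nat.totient_dvd_of_dvd hqq)
    rw [Nat.totient_mul_of_prime_of_dvd hq dvd_rfl]
    exact dvd_mul_right _ _
  exact hq.one_lt.ne' (Nat.dvd_one.1 (h ▸ Nat.dvd_gcd ((dvd_mul_right q q).trans hqq) hdvd))

theorem not_dvd_sub_one_of_coprime_totient {n q r : ℕ} (h : Nat.gcd n n.totient = 1)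
    (hq : q.Prime) (hqn : q ∣ n) (hr : r.Prime) (hrn : r ∣ n) : ¬ r ∣ q - 1 := by
  intro hd
  rw [← Nat.totient_prime hq] at hd
  exact hr.one_lt.ne'
    (Nat.dvd_one.1 (h ▸ Nat.dvd_gcd hrn (hd.trans (Nat.totient_dvd_of_dvd hqn))))

theorem le_two_of_prime_pow_dvd_sq {n q k : ℕ} (hn : Squarefree n) (hq : q.Prime)
    (hd : q ^ k ∣ n ^ 2) : k ≤ 2 := by
  have h₁ := (hq.pow_dvd_iff_le_factorization (pow_ne_zero 2 hn.ne_zero)).1 hd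
  have h₂ := hn.natFactorization_le_one q
  simp only [Nat.factorization_pow, Finsupp.smul_apply, smul_eq_mul] at h₁
  omega

/-- If `|G|` divides `n ^ 2` with `gcd(n, φ(n)) = 1`, an element of order `n` centralizes every
normal abelian `q`-subgroup. -/
theorem commute_of_mem_normal_isPGroup {G : Type*} [Group G] [Finite G] {n q : ℕ} (hn : 0 < n)
    (h : Nat.gcd n n.totient = 1) (hG : Nat.card G ∣ n ^ 2) (hq : q.Prime) (Q : Subgroup G)
    [Q.Normal] (hQ : IsPGroup q Q) (hQc : ∀ x ∈ Q, ∀ y ∈ Q, x * y = y * x) {a : G}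
    (ha : orderOf a = n) {x : G} (hx : x ∈ Q) : a * x = x * a := by
  have := Fact.mk hq
  have hsq := squarefree_of_coprime_totient h
  obtain ⟨k, hk⟩ := IsPGroup.iff_card.1 hQ
  have hk2 : k ≤ 2 :=
    le_two_of_prime_pow_dvd_sq hsq hq (hk ▸ Q.card_subgroup_dvd_card.trans hG)
  let α : MulAut Q := MulAut.conjNormal a
  have hαn : α ^ n = 1 := by rw [← map_pow, ← ha, pow_orderOf_eq_one, map_one]
  have hαr : ∀ r, r.Prime → r ∣ n → α ^ (n / r) = 1 := by
    intro r hr hrn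
    rcases Nat.eq_zero_or_pos k with rfl | hkpos
    · have : Subsingleton Q := (Nat.card_eq_one_iff_unique.1 (by simpa using hk)).1
      ext y
      exact congrArg _ (Subsingleton.elim _ _)
    have hqn : q ∣ n := hq.dvd_of_dvd_pow
      (((dvd_pow_self q hkpos.ne').trans (hk ▸ Q.card_subgroup_dvd_card)).trans hG)
    have haq : k = 2 → a ^ (n / q) ∈ Q := by
      rintro rfl
      have hz : IsPGroup q (Subgroup.zpowers (a ^ (n / q))) := by
        apply IsPGroup.of_card (n := 1)
        rw [Nat.card_zpowers, orderOf_pow_of_dvd (Nat.div_pos (Nat.le_of_dvd hn hqn) hq.pos).ne'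
          (ha.symm ▸ Nat.div_dvd_of_dvd hqn), ha, Nat.div_div_self hqn hn.ne', pow_one]
      obtain ⟨j, hj⟩ := IsPGroup.iff_card.1 (hQ.to_sup_of_normal_left hz)
      have hj2 : j ≤ 2 := le_two_of_prime_pow_dvd_sq hsq hq
        (hj ▸ (Subgroup.card_subgroup_dvd_card _).trans hG)
      have heq : Q = Q ⊔ Subgroup.zpowers (a ^ (n / q)) := by
        apply Subgroup.eq_of_le_of_card_ge le_sup_left
        rw [hj, hk]
        exact Nat.pow_le_pow_right hq.pos hj2
      rw [heq]
      exact Subgroup.mem_sup_right (Subgroup.mem_zpowers _)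
    have haq_ne : a ^ (n / q) ≠ 1 := by
      intro e
      have hle := Nat.le_of_dvd (Nat.div_pos (Nat.le_of_dvd hn hqn) hq.pos)
        (ha ▸ orderOf_dvd_of_pow_eq_one e)
      exact absurd hle (not_le.2 (Nat.div_lt_self hn hq.one_lt))
    by_cases hcase : r = q ∧ k = 2
    · obtain ⟨rfl, hk'⟩ := hcase
      rw [← map_pow]
      ext y
      rw [MulAut.conjNormal_apply, hQc _ (haq hk') _ y.2, mul_inv_cancel_right]
      rfl
    refine mulAut_eq_one_of_pow_eq_one hq hr hk hk2
      (not_dvd_sub_one_of_coprime_totient h hq hqn hr hrn) _ ?_ ?_ ?_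
    · rw [← pow_mul, Nat.div_mul_cancel hrn, hαn]
    · intro e
      by_contra hlt
      exact hcase ⟨e, by omega⟩
    · intro e
      refine ⟨⟨a ^ (n / q), haq e⟩, fun e' => haq_ne (congrArg Subtype.val e'), ?_⟩
      rw [← map_pow]
      apply Subtype.ext
      rw [MulAut.conjNormal_apply]
      change a ^ (n / r) * a ^ (n / q) * (a ^ (n / r))⁻¹ = a ^ (n / q)
      rw [(Commute.pow_pow_self a _ _).eq, mul_inv_cancel_right]
  have hα : α = 1 := by
    rw [← orderOf_eq_one_iff]
    by_contra hne
    obtain ⟨r, hr, hrd⟩ := Nat.exists_prime_and_dvd hne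
    have hrn : r ∣ n := hrd.trans (orderOf_dvd_of_pow_eq_one hαn)
    have hr' : r ∣ n / r := hrd.trans (orderOf_dvd_of_pow_eq_one (hαr r hr hrn))
    have hrr : r * r ∣ n := by
      conv_rhs => rw [← Nat.div_mul_cancel hrn]
      exact mul_dvd_mul_right hr' r
    exact hr.one_lt.ne' (Nat.isUnit_iff.1 (hsq r hrr))
  have e := congrArg Subtype.val (DFunLike.congr_fun hα ⟨x, hx⟩)
  rw [MulAut.conjNormal_apply] at e
  exact mul_inv_eq_iff_eq_mul.1 e

/-- If every normal abelian `q`-subgroup, `q` prime, is central, then so is every normal abelian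
subgroup. -/
theorem le_center_of_isPGroup_le_center {G : Type*} [Group G] [Finite G]
    (hp : ∀ q : ℕ, q.Prime → ∀ Q : Subgroup G, Q.Normal → IsPGroup q Q →
      (∀ x ∈ Q, ∀ y ∈ Q, x * y = y * x) → Q ≤ Subgroup.center G)
    (M : Subgroup G) (hM : M.Normal) (hMc : ∀ x ∈ M, ∀ y ∈ M, x * y = y * x) :
    M ≤ Subgroup.center G := by
  intro x hx
  have hpow : ∀ q : ℕ, q.Prime →
      x ^ (Nat.card G / q ^ (Nat.card G).factorization q) ∈ Subgroup.center G := by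
    intro q hq
    set v := (Nat.card G).factorization q
    let Q : Subgroup G :=
      { carrier := {y | y ∈ M ∧ y ^ q ^ v = 1}
        one_mem' := ⟨one_mem _, one_pow _⟩
        mul_mem' := fun {y z} hy hz => ⟨mul_mem hy.1 hz.1, by
          rw [Commute.mul_pow (hMc y hy.1 z hz.1), hy.2, hz.2, one_mul]⟩
        inv_mem' := fun {y} hy => ⟨inv_mem hy.1, by rw [inv_pow, hy.2, inv_one]⟩ }
    refine hp q hq Q ⟨fun y hy g => ⟨hM.conj_mem y hy.1 g, ?_⟩⟩ (fun y => ⟨v, ?_⟩)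
      (fun y hy z hz => hMc y hy.1 z hz.1) ⟨pow_mem hx _, ?_⟩
    · rw [conj_pow, hy.2, mul_one, mul_inv_cancel]
    · exact Subtype.ext y.2.2
    · rw [← pow_mul, Nat.div_mul_cancel (Nat.ordProj_dvd _ _), pow_card_eq_one']
  rw [← QuotientGroup.eq_one_iff, ← orderOf_eq_one_iff]
  by_contra hne
  obtain ⟨q, hq, hqd⟩ := Nat.exists_prime_and_dvd hne
  refine Nat.not_dvd_ordCompl hq (Nat.card_pos (α := G)).ne' (hqd.trans (orderOf_dvd_of_pow_eq_one ?_))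
  rw [← QuotientGroup.mk_pow, QuotientGroup.eq_one_iff]
  exact hpow q hq

/-- If `gcd(n, φ(n)) = 1`, then every finite group factorisable as a product of two
cyclic subgroups of order `n` is abelian. -/
theorem singular_bicyclic_abelian (n : ℕ) (hn : 0 < n)
    (h : Nat.gcd n (Nat.totient n) = 1)
    (G : Type*) [Group G] [Finite G] (a b : G)
    (ha : orderOf a = n) (hb : orderOf b = n)
    (hfact : ∀ g : G, ∃ i j : ℤ, g = a ^ i * b ^ j) :
    ∀ x y : G, x * y = y * x := by
  have hAB : ∀ g : G, ∃ x ∈ Subgroup.zpowers a, ∃ y ∈ Subgroup.zpowers b, g = x * y := fun g =>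
    let ⟨i, j, e⟩ := hfact g
    ⟨_, ⟨i, rfl⟩, _, ⟨j, rfl⟩, e⟩
  have hG : Nat.card G ∣ n ^ 2 := by
    have := card_dvd_mul_card_of_factorization _ _ hAB
    rwa [Nat.card_zpowers, Nat.card_zpowers, ha, hb, ← pow_two] at this
  have mem_center : ∀ z : G, Commute a z → Commute b z → z ∈ Subgroup.center G := by
    refine fun z haz hbz => Subgroup.mem_center_iff.2 fun g => ?_
    obtain ⟨i, j, rfl⟩ := hfact g
    exact ((haz.zpow_left i).mul_left (hbz.zpow_left j)).eq
  have central : ∀ M : Subgroup G, M.Normal → (∀ x ∈ M, ∀ y ∈ M, x * y = y * x) →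
      M ≤ Subgroup.center G :=
    le_center_of_isPGroup_le_center fun q hq Q hQ hQp hQc x hx => mem_center x
      (commute_of_mem_normal_isPGroup hn h hG hq Q hQp hQc ha hx)
      (commute_of_mem_normal_isPGroup hn h hG hq Q hQp hQc hb hx)
  have zcomm : ∀ g : G, ∀ x ∈ Subgroup.zpowers g, ∀ y ∈ Subgroup.zpowers g, x * y = y * x := by
    rintro g _ ⟨i, rfl⟩ _ ⟨j, rfl⟩
    exact (Commute.zpow_zpow_self g i j).eq
  obtain ⟨M, hMn, hMc, hM⟩ :=
    exists_normal_abelian_of_factorization _ _ (zcomm a) (zcomm b) hAB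
  have hcomm : ∀ j : ℤ, ⁅a, b ^ j⁆ ∈ Subgroup.center G := fun j =>
    central M hMn hMc (hM a (Subgroup.mem_zpowers a) _ ⟨j, rfl⟩)
  let S : Set G := insert a (Subgroup.center G)
  have hS : ∀ x ∈ S, ∀ y ∈ S, x * y = y * x := by
    rintro x (rfl | hx) y (rfl | hy)
    · rfl
    · exact Subgroup.mem_center_iff.1 hy x
    · exact (Subgroup.mem_center_iff.1 hx y).symm
    · exact Subgroup.mem_center_iff.1 hy x
  have hN : (Subgroup.closure S).Normal := by
    have hZ : ∀ z ∈ Subgroup.center G, z ∈ Subgroup.closure S := fun z hz =>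
      Subgroup.subset_closure (Set.mem_insert_of_mem _ hz)
    have haS : a ∈ Subgroup.closure S := Subgroup.subset_closure (Set.mem_insert _ _)
    refine ⟨fun u hu g => ?_⟩
    have hle : Subgroup.closure S ≤ (Subgroup.closure S).comap (MulAut.conj g).toMonoidHom := by
      refine (Subgroup.closure_le _).2 ?_
      rintro v (rfl | hv)
      · obtain ⟨i, j, rfl⟩ := hfact g
        change v ^ i * b ^ j * v * (v ^ i * b ^ j)⁻¹ ∈ Subgroup.closure S
        have e : v ^ i * b ^ j * v * (v ^ i * b ^ j)⁻¹
            = v ^ i * ⁅v, b ^ j⁆⁻¹ * v * (v ^ i)⁻¹ := by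
          simp only [commutatorElement_def]; group
        rw [e]
        exact mul_mem (mul_mem (mul_mem (zpow_mem haS i) (inv_mem (hZ _ (hcomm j)))) haS)
          (inv_mem (zpow_mem haS i))
      · exact hZ _ (Subgroup.instNormalCenter.conj_mem v hv g)
    exact hle hu
  have haZ : a ∈ Subgroup.center G := by
    refine central _ hN (fun x hx y hy => ?_) (Subgroup.subset_closure (Set.mem_insert _ _))
    have := Subgroup.isMulCommutative_closure hS
    exact setLike_mul_comm hx hy
  have hbZ : b ∈ Subgroup.center G :=
    mem_center b (Subgroup.mem_center_iff.1 haZ b).symm (Commute.refl b)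
  intro x y
  obtain ⟨i, j, rfl⟩ := hfact y
  exact Subgroup.mem_center_iff.1 (mul_mem (zpow_mem haZ i) (zpow_mem hbZ j)) x
end

section
/- Let m and n be positive integers with gcd(m, φ(n)) = gcd(n, φ(m)) = 1, and let G be a finite group that factorises as G = AB with A cyclic of order m and B cyclic of order n. Then G is supersolvable. -/
/-- A group is supersolvable if it has a normal series (all terms normal in `G`) with
cyclic factors: each successive quotient is generated by a single element modulo the
previous term. -/
def IsSupersolvable (G : Type*) [Group G] : Prop :=
  ∃ (k : ℕ) (s : Fin (k + 1) → Subgroup G),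
    s 0 = ⊥ ∧ s (Fin.last k) = ⊤ ∧ (∀ i, (s i).Normal) ∧
    ∀ i : Fin k, s i.castSucc ≤ s i.succ ∧
      ∃ g ∈ s i.succ, ∀ h ∈ s i.succ, ∃ z : ℤ, h * (g ^ z)⁻¹ ∈ s i.castSucc

open scoped commutatorElement

open Subgroup in
/-- In a product of two subgroups `A` and `B` with `A` commutative, conjugation by an element of
`A` maps `⁅x, b⁆` to `⁅x, y⁆` with `y ∈ B` independent of `x ∈ A`. -/
theorem exists_conj_commutatorElement_eq {G : Type*} [Group G] {A B : Subgroup G}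
    (hA : ∀ x ∈ A, ∀ y ∈ A, x * y = y * x)
    (hBA : ∀ g : G, ∃ y ∈ B, ∃ x ∈ A, g = y * x) {α b : G} (hα : α ∈ A) :
    ∃ y ∈ B, ∀ x ∈ A, α * ⁅x, b⁆ * α⁻¹ = ⁅x, y⁆ := by
  obtain ⟨y, hy, z, hz, h⟩ := hBA (α * b * α⁻¹)
  refine ⟨y, hy, fun x hx ↦ ?_⟩
  have h1 : α * x * α⁻¹ = x := by rw [hA α hα x hx, mul_inv_cancel_right]
  calc α * ⁅x, b⁆ * α⁻¹ = ⁅α * x * α⁻¹, α * b * α⁻¹⁆ := by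
        simp only [commutatorElement_def]; group
    _ = x * y * (z * x⁻¹) * z⁻¹ * y⁻¹ := by
        rw [h1, h, commutatorElement_def]; group
    _ = ⁅x, y⁆ := by
        rw [hA z hz x⁻¹ (A.inv_mem hx), commutatorElement_def]; group

/-- **Itô's theorem**, generator form: in a product of two commutative subgroups `A` and `B`, any
two commutators of elements of `A` with elements of `B` commute. -/
theorem commutatorElement_mul_comm_of_product {G : Type*} [Group G] {A B : Subgroup G}
    (hA : ∀ x ∈ A, ∀ y ∈ A, x * y = y * x) (hB : ∀ x ∈ B, ∀ y ∈ B, x * y = y * x)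
    (hAB : ∀ g : G, ∃ x ∈ A, ∃ y ∈ B, g = x * y) (hBA : ∀ g : G, ∃ y ∈ B, ∃ x ∈ A, g = y * x)
    {a α b β : G} (ha : a ∈ A) (hα : α ∈ A) (hb : b ∈ B) (hβ : β ∈ B) :
    ⁅a, b⁆ * ⁅α, β⁆ = ⁅α, β⁆ * ⁅a, b⁆ := by
  obtain ⟨b', hb', h⟩ := exists_conj_commutatorElement_eq (b := b) hA hBA (A.inv_mem hα)
  obtain ⟨a', ha', k⟩ := exists_conj_commutatorElement_eq (b := a) hB hAB (B.inv_mem hβ)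
  have k' : ∀ y ∈ B, β⁻¹ * ⁅a, y⁆ * β⁻¹⁻¹ = ⁅a', y⁆ := fun y hy ↦ by
    rw [← commutatorElement_inv y a, ← commutatorElement_inv y a', ← k y hy]; group
  have e : α⁻¹ * (β⁻¹ * ⁅a, b⁆ * β⁻¹⁻¹) * α⁻¹⁻¹ = β⁻¹ * (α⁻¹ * ⁅a, b⁆ * α⁻¹⁻¹) * β⁻¹⁻¹ := by
    rw [k' b hb, h a' ha', h a ha, k' b' hb']
  generalize ⁅a, b⁆ = c at e
  calc c * ⁅α, β⁆ = α * β * (β⁻¹ * (α⁻¹ * c * α⁻¹⁻¹) * β⁻¹⁻¹) * α⁻¹ * β⁻¹ := by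
        rw [commutatorElement_def]; group
    _ = ⁅α, β⁆ * c := by rw [← e, commutatorElement_def]; group

open Subgroup in
theorem relIndex_eq_relIndex_of_product {G : Type*} [Group G] {A V K : Subgroup G} (hV : V ≤ K)
    (h : ∀ g ∈ K, ∃ x ∈ V, ∃ y ∈ A, g = x * y) : A.relIndex V = A.relIndex K := by
  have key (L : Subgroup G) :
      A.relIndex L = (MulAction.orbit L ((1 : G) : G ⧸ A)).ncard := by
    rw [← MulAction.index_stabilizer, relIndex]
    congr 1
    ext g
    rw [mem_subgroupOf, MulAction.mem_stabilizer_iff]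
    change _ ↔ (((g : G) * 1 : G) : G ⧸ A) = _
    rw [mul_one, eq_comm, QuotientGroup.eq]
    simp
  rw [key, key]
  congr 1
  apply Set.Subset.antisymm
  · rintro _ ⟨g, rfl⟩
    exact ⟨⟨g, hV g.2⟩, rfl⟩
  · rintro _ ⟨⟨g, hg⟩, rfl⟩
    obtain ⟨x, hx, y, hy, rfl⟩ := h g hg
    refine ⟨⟨x, hx⟩, ?_⟩
    change ((x * 1 : G) : G ⧸ A) = ((x * y * 1 : G) : G ⧸ A)
    rw [QuotientGroup.eq]
    simpa [mul_assoc] using hy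

theorem Subgroup.mem_of_zpow_mem_of_isCoprime {G : Type*} [Group G] (H : Subgroup G) {x : G}
    {r s : ℤ} (h : IsCoprime r s) (hr : x ^ r ∈ H) (hs : x ^ s ∈ H) : x ∈ H := by
  obtain ⟨u, v, huv⟩ := h
  have : x = (x ^ r) ^ u * (x ^ s) ^ v := by
    rw [← zpow_mul, ← zpow_mul, ← zpow_add, mul_comm r, mul_comm s, huv, zpow_one]
  rw [this]
  exact H.mul_mem (H.zpow_mem hr u) (H.zpow_mem hs v)

theorem ZMod.eq_one_of_pow_eq_one_of_coprime {p m : ℕ} [Fact p.Prime] (hm : 0 < m)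
    (h : m.Coprime (p - 1)) {k : ZMod p} (hk : k ^ m = 1) : k = 1 := by
  have h0 : k ≠ 0 := by
    rintro rfl
    rw [zero_pow hm.ne'] at hk
    exact zero_ne_one hk
  have := Nat.dvd_gcd (orderOf_dvd_of_pow_eq_one hk)
    (orderOf_dvd_of_pow_eq_one (ZMod.pow_card_sub_one_eq_one h0))
  rw [h, Nat.dvd_one] at this
  exact orderOf_eq_one_iff.1 this

open Subgroup in
/-- If `z` is a central element of the commutator subgroup and `z ^ p = 1` with `p` prime, then
`z = 1` unless `p` divides the index of every commutative subgroup. -/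
theorem eq_one_of_mem_commutator_of_not_dvd_index {G : Type*} [Group G] [Finite G]
    (C : Subgroup G) (hC : ∀ x ∈ C, ∀ y ∈ C, x * y = y * x) {p : ℕ} (hp : p.Prime) {z : G}
    (hz : z ∈ commutator G) (hc : z ∈ center G) (hzp : z ^ p = 1) (hi : ¬ p ∣ C.index) :
    z = 1 := by
  let _ : CommGroup C := { mul_comm := fun x y ↦ Subtype.ext (hC x x.2 y y.2) }
  have h1 : MonoidHom.transfer (MonoidHom.id C) z = 1 := Abelianization.commutator_subset_ker _ hz
  rw [MonoidHom.transfer_eq_pow] at h1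
  · have h2 : z ^ C.index = 1 := congrArg Subtype.val h1
    have := Nat.dvd_gcd (orderOf_dvd_of_pow_eq_one hzp) (orderOf_dvd_of_pow_eq_one h2)
    rw [(Nat.Prime.coprime_iff_not_dvd hp).2 hi, Nat.dvd_one] at this
    exact orderOf_eq_one_iff.1 this
  · intro k g₀ _
    have := mem_center_iff.1 (pow_mem hc k) g₀
    rw [mul_assoc, ← this, inv_mul_cancel_left]

theorem Nat.Coprime.coprime_sub_one_of_dvd {m n p : ℕ} (h : m.Coprime n.totient) (hp : p.Prime)
    (hpn : p ∣ n) : m.Coprime (p - 1) :=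
  h.coprime_dvd_right (by rw [← Nat.totient_prime hp]; exact Nat.totient_dvd_of_dvd hpn)

theorem Nat.Coprime.not_sq_dvd_of_dvd {m n p : ℕ} (h : n.Coprime m.totient) (hp : p.Prime)
    (hpn : p ∣ n) : ¬ p ^ 2 ∣ m := by
  intro hm
  have h1 : p ∣ m.totient := by
    refine dvd_trans ?_ (Nat.totient_dvd_of_dvd hm)
    rw [Nat.totient_prime_pow hp two_pos]
    exact ⟨p - 1, by simp⟩
  exact hp.one_lt.ne' (Nat.dvd_one.1 (h ▸ Nat.dvd_gcd hpn h1))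

section Bicyclic

variable {G : Type*} [Group G] {a b : G}

theorem bicyclic_swap (h : ∀ g : G, ∃ i j : ℤ, g = a ^ i * b ^ j) (g : G) :
    ∃ i j : ℤ, g = b ^ i * a ^ j := by
  obtain ⟨i, j, hg⟩ := h g⁻¹
  exact ⟨-j, -i, by rw [← inv_inv g, hg, mul_inv_rev, zpow_neg, zpow_neg]⟩

open Subgroup

theorem zpowers_mul_comm (a : G) : ∀ x ∈ zpowers a, ∀ y ∈ zpowers a, x * y = y * x := by
  rintro _ ⟨i, rfl⟩ _ ⟨j, rfl⟩
  exact (Commute.refl a).zpow_zpow i j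

theorem bicyclic_index (h : ∀ g : G, ∃ i j : ℤ, g = a ^ i * b ^ j) :
    (zpowers a).index = (zpowers a).relIndex (zpowers b) := by
  rw [← relIndex_top_right, eq_comm]
  refine relIndex_eq_relIndex_of_product le_top fun g _ ↦ ?_
  obtain ⟨i, j, hg⟩ := bicyclic_swap h g
  exact ⟨_, ⟨i, rfl⟩, _, ⟨j, rfl⟩, hg⟩

theorem bicyclic_index_dvd [Finite G] (h : ∀ g : G, ∃ i j : ℤ, g = a ^ i * b ^ j) :
    (zpowers a).index ∣ orderOf b := by
  rw [bicyclic_index h, ← Nat.card_zpowers]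
  exact relIndex_dvd_card _ _

theorem relIndex_dvd_index_of_normal_right (A V : Subgroup G) [V.Normal] :
    A.relIndex V ∣ A.index := by
  rw [relIndex_eq_relIndex_of_product (le_sup_right : V ≤ A ⊔ V)]
  · exact relIndex_dvd_index_of_le le_sup_left
  · intro g hg
    rw [sup_comm, mem_sup_of_normal_left] at hg
    obtain ⟨x, hx, y, hy, rfl⟩ := hg
    exact ⟨x, hx, y, hy, rfl⟩

theorem card_dvd_of_le_zpowers [Finite G] {V : Subgroup G} {p : ℕ} (hV : V ≤ zpowers b)
    (hp : ∀ x ∈ V, x ^ p = 1) : Nat.card V ∣ p := by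
  have : IsCyclic V := isCyclic_of_injective (Subgroup.inclusion hV) (inclusion_injective hV)
  rw [← IsCyclic.exponent_eq_card]
  exact Monoid.exponent_dvd_of_forall_pow_eq_one fun x ↦ Subtype.ext (hp x x.2)

/-- The relative index of `⟨a⟩` in a normal elementary abelian `p`-subgroup is `1`, or it is `p`
and `p` divides the order of `b`. -/
theorem bicyclic_relIndex [Finite G] (h : ∀ g : G, ∃ i j : ℤ, g = a ^ i * b ^ j)
    (h1 : (orderOf a).Coprime (orderOf b).totient)
    {p : ℕ} (hp : p.Prime) {V : Subgroup G} [V.Normal] (hVp : ∀ x ∈ V, x ^ p = 1) :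
    V ≤ zpowers a ∨ ((zpowers a).relIndex V = p ∧ p ∣ orderOf b) := by
  have : Fact p.Prime := ⟨hp⟩
  have hpow : ∀ A : Subgroup G, ∃ k, A.relIndex V = p ^ k := fun A ↦ by
    have hV : IsPGroup p V := fun x ↦ ⟨1, Subtype.ext (by simpa using hVp x x.2)⟩
    obtain ⟨k, hk⟩ := IsPGroup.iff_card.1 hV
    obtain ⟨j, -, hj⟩ := (Nat.dvd_prime_pow hp).1 (hk ▸ relIndex_dvd_card A V)
    exact ⟨j, hj⟩
  obtain ⟨k, hk⟩ := hpow (zpowers a)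
  have hd : p ^ k ∣ orderOf b :=
    hk ▸ (relIndex_dvd_index_of_normal_right _ V).trans (bicyclic_index_dvd h)
  rcases k.eq_zero_or_pos with rfl | hk0
  · left
    rwa [pow_zero, relIndex_eq_one] at hk
  right
  have hpb : p ∣ orderOf b := (dvd_pow_self p hk0.ne').trans hd
  refine ⟨?_, hpb⟩
  by_cases hpa : p ∣ orderOf a
  · have hk2 : k < 2 := by
      by_contra! hk2
      exact h1.not_sq_dvd_of_dvd hp hpa ((pow_dvd_pow p hk2).trans hd)
    rw [hk, show k = 1 by omega, pow_one]
  · obtain ⟨l, hl⟩ := hpow (zpowers b)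
    have hl0 : l = 0 := by
      by_contra hl0
      exact hpa ((dvd_pow_self p hl0).trans (hl ▸
        (relIndex_dvd_index_of_normal_right _ V).trans (bicyclic_index_dvd (bicyclic_swap h))))
    rw [hl0, pow_zero, relIndex_eq_one] at hl
    rcases (Nat.dvd_prime hp).1
      ((relIndex_dvd_card (zpowers a) V).trans (card_dvd_of_le_zpowers hl hVp)) with h | h
    · rw [hk] at h
      exact absurd (Nat.pow_eq_one.1 h) (by simp [hp.one_lt.ne', hk0.ne'])
    · exact h

theorem bicyclic_commute [Finite G] (h : ∀ g : G, ∃ i j : ℤ, g = a ^ i * b ^ j)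
    (h2 : (orderOf b).Coprime (orderOf a).totient) (h1 : (orderOf a).Coprime (orderOf b).totient)
    {p : ℕ} (hp : p.Prime) {V : Subgroup G} [V.Normal] (hVc : ∀ x ∈ V, ∀ y ∈ V, x * y = y * x)
    (hVp : ∀ x ∈ V, x ^ p = 1) {x : G} (hx : x ∈ V) : Commute a x := by
  have : Fact p.Prime := ⟨hp⟩
  by_cases hxa : x ∈ zpowers a
  · exact zpowers_mul_comm a a (mem_zpowers a) x hxa
  obtain hVa | ⟨hi, hpb⟩ := bicyclic_relIndex h h1 hp hVp
  · exact absurd (hVa hx) hxa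
  have hpint : Prime (p : ℤ) := Nat.prime_iff_prime_int.1 hp
  have hcard : ∀ y ∈ V, ∃ k : ℤ, ∃ w ∈ zpowers a ⊓ V, y = x ^ k * w := by
    intro y hy
    let _ : CommGroup V := { mul_comm := fun x y ↦ Subtype.ext (hVc x x.2 y y.2) }
    have hq : (QuotientGroup.mk ⟨x, hx⟩ : V ⧸ (zpowers a).subgroupOf V) ≠ 1 := by
      rw [Ne, QuotientGroup.eq_one_iff, mem_subgroupOf]
      exact hxa
    obtain ⟨k, hk⟩ := mem_zpowers_of_prime_card hi hq (g' := QuotientGroup.mk ⟨y, hy⟩)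
    refine ⟨k, (x ^ k)⁻¹ * y, ⟨?_, V.mul_mem (V.inv_mem (V.zpow_mem hx k)) hy⟩, by group⟩
    have hk' : QuotientGroup.mk (s := (zpowers a).subgroupOf V) (⟨x, hx⟩ ^ k) =
        QuotientGroup.mk ⟨y, hy⟩ := hk
    have hmem := QuotientGroup.eq.1 hk'
    exact hmem
  obtain ⟨k, w, ⟨hwa, hwV⟩, hk⟩ := hcard (a * x * a⁻¹) (Normal.conj_mem ‹_› x hx a)
  have hxw : Commute x w := hVc x hx w hwV
  have hiter (i : ℕ) : ∃ v ∈ zpowers a, a ^ i * x * (a ^ i)⁻¹ = x ^ (k ^ i) * v := by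
    induction i with
    | zero => exact ⟨1, one_mem _, by simp⟩
    | succ i ih =>
      obtain ⟨v, hv, e⟩ := ih
      refine ⟨w ^ (k ^ i) * v, mul_mem (Subgroup.zpow_mem _ hwa _) hv, ?_⟩
      have hav := zpowers_mul_comm a a (mem_zpowers a) v hv
      calc a ^ (i + 1) * x * (a ^ (i + 1))⁻¹ = a * (a ^ i * x * (a ^ i)⁻¹) * a⁻¹ := by
            rw [pow_succ']; group
        _ = a * x ^ (k ^ i) * (v * a⁻¹) := by rw [e]; group
        _ = (a * x * a⁻¹) ^ (k ^ i) * v := by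
            rw [conj_zpow, show v * a⁻¹ = a⁻¹ * v from
              ((show Commute a v from hav).inv_left.eq).symm]
            group
        _ = x ^ (k ^ (i + 1)) * (w ^ (k ^ i) * v) := by
            rw [hk, (hxw.zpow_left k).mul_zpow, ← zpow_mul, ← pow_succ', mul_assoc]
  have hk1 : (k : ZMod p) = 1 := by
    refine ZMod.eq_one_of_pow_eq_one_of_coprime (orderOf_pos a)
      (h1.coprime_sub_one_of_dvd hp hpb) ?_
    obtain ⟨v, hv, e⟩ := hiter (orderOf a)
    rw [pow_orderOf_eq_one, one_mul, inv_one, mul_one] at e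
    by_contra hne
    have hnd : ¬ (p : ℤ) ∣ 1 - k ^ orderOf a := by
      rw [← ZMod.intCast_zmod_eq_zero_iff_dvd]
      push_cast
      rw [sub_eq_zero]
      exact Ne.symm hne
    refine hxa (mem_of_zpow_mem_of_isCoprime _ ((hpint.coprime_iff_not_dvd).2 hnd) ?_ ?_)
    · rw [zpow_natCast, hVp x hx]
      exact one_mem _
    · rw [sub_eq_neg_add, zpow_add, zpow_one, zpow_neg]
      nth_rw 2 [e]
      rwa [inv_mul_cancel_left]
  have hxk : x ^ k = x := by
    rw [← Int.cast_one, ZMod.intCast_eq_intCast_iff, Int.modEq_iff_dvd] at hk1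
    obtain ⟨c, hc⟩ := hk1
    rw [show k = 1 - p * c by omega, zpow_sub, zpow_one, zpow_mul, zpow_natCast, hVp x hx,
      one_zpow, inv_one, mul_one]
  rw [hxk] at hk
  have hmem {i : ℤ} : a ^ i ∈ centralizer {x} ↔ Commute (a ^ i) x :=
    mem_centralizer_singleton_iff
  have hap : a ^ (p : ℤ) ∈ centralizer {x} := by
    have : ∀ i : ℕ, a ^ i * x * (a ^ i)⁻¹ = x * w ^ i := by
      intro i
      induction i with
      | zero => simp
      | succ i ih =>
        have haw : Commute a (w ^ i) :=
          (show Commute a w from zpowers_mul_comm a a (mem_zpowers a) w hwa).pow_right i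
        calc a ^ (i + 1) * x * (a ^ (i + 1))⁻¹ = a * (a ^ i * x * (a ^ i)⁻¹) * a⁻¹ := by
              rw [pow_succ']; group
          _ = a * x * (w ^ i * a⁻¹) := by rw [ih]; group
          _ = a * x * a⁻¹ * w ^ i := by rw [← haw.inv_left.eq]; group
          _ = x * w ^ (i + 1) := by rw [hk, pow_succ', mul_assoc]
    rw [hmem, zpow_natCast]
    have := this p
    rw [hVp w hwV, mul_one] at this
    exact mul_inv_eq_iff_eq_mul.1 this
  obtain ⟨j, rfl⟩ := hwa
  change Commute x (a ^ j) at hxw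
  by_cases hpj : (p : ℤ) ∣ j
  · have hw : a ^ j = 1 := by
      have hpa2 := h2.not_sq_dvd_of_dvd hp hpb
      have e : a ^ (j * p) = 1 := by rw [zpow_mul, zpow_natCast]; exact hVp _ hwV
      rw [← orderOf_dvd_iff_zpow_eq_one] at e ⊢
      obtain ⟨j', rfl⟩ := hpj
      by_cases hpa : p ∣ orderOf a
      · obtain ⟨m', hm'⟩ := hpa
        rw [hm'] at e hpa2 ⊢
        have hp0 : (p : ℤ) ≠ 0 := hpint.ne_zero
        push_cast at e ⊢
        rw [mul_assoc, mul_dvd_mul_iff_left hp0] at e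
        refine mul_dvd_mul_left _ (IsCoprime.dvd_of_dvd_mul_right ?_ e)
        refine ((hpint.coprime_iff_not_dvd).2 ?_).symm
        rw [Int.natCast_dvd_natCast]
        exact fun hd ↦ hpa2 (by rw [sq]; exact mul_dvd_mul_left p hd)
      · have hcop : IsCoprime (orderOf a : ℤ) p :=
          ((hpint.coprime_iff_not_dvd).2 (by rwa [Int.natCast_dvd_natCast])).symm
        exact hcop.dvd_of_dvd_mul_right e
    change a * x * a⁻¹ = x * a ^ j at hk
    rw [hw, mul_one] at hk
    exact mul_inv_eq_iff_eq_mul.1 hk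
  · exact mem_centralizer_singleton_iff.1 (mem_of_zpow_mem_of_isCoprime _
      ((hpint.coprime_iff_not_dvd).2 hpj) hap (hmem.2 hxw.symm))

theorem bicyclic_center [Finite G] (h : ∀ g : G, ∃ i j : ℤ, g = a ^ i * b ^ j)
    (h2 : (orderOf b).Coprime (orderOf a).totient) (h1 : (orderOf a).Coprime (orderOf b).totient)
    {p : ℕ} (hp : p.Prime) {V : Subgroup G} [V.Normal] (hVc : ∀ x ∈ V, ∀ y ∈ V, x * y = y * x)
    (hVp : ∀ x ∈ V, x ^ p = 1) : V ≤ center G := by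
  intro x hx
  rw [mem_center_iff]
  intro g
  obtain ⟨i, j, rfl⟩ := h g
  exact ((bicyclic_commute h h2 h1 hp hVc hVp hx).zpow_left i).mul_left
    ((bicyclic_commute (bicyclic_swap h) h1 h2 hp hVc hVp hx).zpow_left j)

/-- If `p ^ 2` does not divide the order of `b`, every central element `z` of the commutator
subgroup with `z ^ p = 1` lies in `⟨a⟩`. -/
theorem bicyclic_mem_zpowers [Finite G] (h : ∀ g : G, ∃ i j : ℤ, g = a ^ i * b ^ j)
    {p : ℕ} (hp : p.Prime) (hpb : ¬ p ^ 2 ∣ orderOf b) {z : G} (hz : z ∈ commutator G)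
    (hc : z ∈ center G) (hzp : z ^ p = 1) : z ∈ zpowers a := by
  by_contra hza
  refine hza ?_
  have hcen : ∀ g, g * z = z * g := mem_center_iff.1 hc
  have hn : (zpowers z).Normal := ⟨by
    rintro _ ⟨k, rfl⟩ g
    exact ⟨k, by
      rw [show g * z ^ k = z ^ k * g from (show Commute g z from hcen g).zpow_right k,
        mul_inv_cancel_right]⟩⟩
  have hmem : ∀ g ∈ zpowers a ⊔ zpowers z, ∃ i j : ℤ, g = a ^ i * z ^ j := by
    intro g hg
    rw [mem_sup_of_normal_right] at hg
    obtain ⟨_, ⟨i, rfl⟩, _, ⟨j, rfl⟩, rfl⟩ := hg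
    exact ⟨i, j, rfl⟩
  have hz1 : z = 1 := by
    refine eq_one_of_mem_commutator_of_not_dvd_index (zpowers a ⊔ zpowers z) ?_ hp hz hc hzp ?_
    · intro x hx y hy
      obtain ⟨i, j, rfl⟩ := hmem x hx
      obtain ⟨k, l, rfl⟩ := hmem y hy
      have haz : Commute a z := hcen a
      exact (((Commute.refl a).zpow_zpow i k).mul_right (haz.zpow_zpow i l)).mul_left
        ((haz.symm.zpow_zpow j k).mul_right ((Commute.refl z).zpow_zpow j l))
    · intro hd
      refine hpb (dvd_trans ?_ (bicyclic_index_dvd h))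
      rw [← relIndex_mul_index (le_sup_left : zpowers a ≤ zpowers a ⊔ zpowers z), sq]
      refine mul_dvd_mul ?_ hd
      have e : (zpowers a).relIndex (zpowers z) = (zpowers a).relIndex (zpowers a ⊔ zpowers z) := by
        refine relIndex_eq_relIndex_of_product le_sup_right fun g hg ↦ ?_
        obtain ⟨i, j, rfl⟩ := hmem g hg
        exact ⟨_, ⟨j, rfl⟩, _, ⟨i, rfl⟩, (show Commute a z from hcen a).zpow_zpow i j⟩
      rw [← e]
      have hzc : Nat.card (zpowers z) ∣ p := by
        rw [Nat.card_zpowers]; exact orderOf_dvd_of_pow_eq_one hzp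
      rcases (Nat.dvd_prime hp).1 ((relIndex_dvd_card (zpowers a) (zpowers z)).trans hzc) with h | h
      · rw [relIndex_eq_one, zpowers_le] at h
        exact absurd h hza
      · rw [h]
  rw [hz1]
  exact one_mem _

theorem bicyclic_eq_one [Finite G] (h : ∀ g : G, ∃ i j : ℤ, g = a ^ i * b ^ j)
    (h2 : (orderOf b).Coprime (orderOf a).totient) (h1 : (orderOf a).Coprime (orderOf b).totient)
    {p : ℕ} (hp : p.Prime) {z : G} (hz : z ∈ commutator G) (hc : z ∈ center G)
    (hzp : z ^ p = 1) : z = 1 := by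
  have : Fact p.Prime := ⟨hp⟩
  by_cases hpb : p ∣ orderOf b
  · by_cases hpa : p ∣ orderOf a
    · have hb2 := h1.not_sq_dvd_of_dvd hp hpa
      have hza := bicyclic_mem_zpowers h hp hb2 hz hc hzp
      have hzb := bicyclic_mem_zpowers (bicyclic_swap h) hp (h2.not_sq_dvd_of_dvd hp hpb) hz hc hzp
      by_contra hz1
      refine hz1 (eq_one_of_mem_commutator_of_not_dvd_index _ (zpowers_mul_comm a) hp hz hc hzp
        fun hd ↦ hb2 ?_)
      have hcard : (zpowers a ⊓ zpowers b).relIndex (zpowers b) * Nat.card ↥(zpowers a ⊓ zpowers b)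
          = orderOf b := by
        rw [← Nat.card_zpowers b, mul_comm, ← relIndex_bot_left, ← relIndex_bot_left]
        exact relIndex_mul_relIndex _ _ _ bot_le inf_le_right
      rw [inf_relIndex_right, ← bicyclic_index h] at hcard
      rw [← hcard, sq]
      refine mul_dvd_mul hd ?_
      rw [← orderOf_eq_prime_iff.2 ⟨hzp, hz1⟩, ← Nat.card_zpowers]
      exact card_dvd_of_le (zpowers_le.2 ⟨hza, hzb⟩)
    · exact eq_one_of_mem_commutator_of_not_dvd_index _ (zpowers_mul_comm b) hp hz hc hzp
        fun hd ↦ hpa (hd.trans (bicyclic_index_dvd (bicyclic_swap h)))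
  · exact eq_one_of_mem_commutator_of_not_dvd_index _ (zpowers_mul_comm a) hp hz hc hzp
      fun hd ↦ hpb (hd.trans (bicyclic_index_dvd h))

theorem bicyclic_commute_generators [Finite G] (h : ∀ g : G, ∃ i j : ℤ, g = a ^ i * b ^ j)
    (h2 : (orderOf b).Coprime (orderOf a).totient)
    (h1 : (orderOf a).Coprime (orderOf b).totient) : Commute a b := by
  have hAB (g : G) : ∃ x ∈ zpowers a, ∃ y ∈ zpowers b, g = x * y := by
    obtain ⟨i, j, hg⟩ := h g
    exact ⟨_, ⟨i, rfl⟩, _, ⟨j, rfl⟩, hg⟩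
  have hBA (g : G) : ∃ x ∈ zpowers b, ∃ y ∈ zpowers a, g = x * y := by
    obtain ⟨i, j, hg⟩ := bicyclic_swap h g
    exact ⟨_, ⟨i, rfl⟩, _, ⟨j, rfl⟩, hg⟩
  have hA := zpowers_mul_comm a
  have hB := zpowers_mul_comm b
  set H : Subgroup G := ⁅zpowers a, zpowers b⁆ with hH
  have hHcomm : ∀ x ∈ H, ∀ y ∈ H, x * y = y * x := by
    have : IsMulCommutative H := isMulCommutative_closure (by
      rintro _ ⟨x, hx, y, hy, rfl⟩ _ ⟨x', hx', y', hy', rfl⟩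
      exact commutatorElement_mul_comm_of_product hA hB hAB hBA hx hx' hy hy')
    exact fun x hx y hy ↦ setLike_mul_comm hx hy
  have hconj : ∀ c ∈ H, ∀ g : G, g * c * g⁻¹ ∈ H := by
    have key : ∀ g : G, (∀ x ∈ zpowers a, ∀ y ∈ zpowers b, g * ⁅x, y⁆ * g⁻¹ ∈ H) →
        ∀ c ∈ H, g * c * g⁻¹ ∈ H := by
      intro g hg c hc
      have : H ≤ H.comap (MulAut.conj g).toMonoidHom := by
        rw [hH, commutator_le]
        exact hg
      exact this hc
    intro c hc g
    obtain ⟨α, hα, β, hβ, rfl⟩ := hAB g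
    have h3 : β * c * β⁻¹ ∈ H := by
      refine key β (fun x hx y hy ↦ ?_) c hc
      obtain ⟨x', hx', e⟩ := exists_conj_commutatorElement_eq (b := x) hB hAB hβ
      have := H.inv_mem (commutator_mem_commutator hx' hy)
      rw [commutatorElement_inv, ← e y hy, ← H.inv_mem_iff] at this
      simpa [mul_assoc] using this
    have h4 : α * (β * c * β⁻¹) * α⁻¹ ∈ H := by
      refine key α (fun x hx y hy ↦ ?_) _ h3
      obtain ⟨y', hy', e⟩ := exists_conj_commutatorElement_eq (b := y) hA hBA hα
      rw [e x hx]
      exact commutator_mem_commutator hx hy'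
    simpa [mul_assoc] using h4
  by_contra hab
  have hcard : Nat.card H ≠ 1 := by
    rw [Ne, card_eq_one]
    intro hbot
    have : ⁅a, b⁆ ∈ H := commutator_mem_commutator (mem_zpowers a) (mem_zpowers b)
    rw [hbot, mem_bot, commutatorElement_eq_one_iff_commute] at this
    exact hab this
  obtain ⟨p, hp, hpd⟩ := Nat.exists_prime_and_dvd hcard
  have : Fact p.Prime := ⟨hp⟩
  obtain ⟨⟨z, hzH⟩, hz⟩ := exists_prime_orderOf_dvd_card' p hpd
  rw [orderOf_mk] at hz
  let V : Subgroup G :=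
    { carrier := {x | x ∈ H ∧ x ^ p = 1}
      one_mem' := ⟨one_mem _, one_pow p⟩
      mul_mem' := fun {x y} hx hy ↦ ⟨mul_mem hx.1 hy.1, by
        rw [(show Commute x y from hHcomm x hx.1 y hy.1).mul_pow, hx.2, hy.2, one_mul]⟩
      inv_mem' := fun {x} hx ↦ ⟨inv_mem hx.1, by rw [inv_pow, hx.2, inv_one]⟩ }
  have hVn : V.Normal := ⟨fun x hx g ↦ ⟨hconj x hx.1 g, by
    rw [conj_pow, hx.2, mul_one, mul_inv_cancel]⟩⟩
  have hzV : z ∈ V := ⟨hzH, hz ▸ pow_orderOf_eq_one z⟩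
  have hzc := bicyclic_center h h2 h1 hp
    (fun x (hx : x ∈ H ∧ _) y (hy : y ∈ H ∧ _) ↦ hHcomm x hx.1 y hy.1) (fun x (hx : x ∈ H ∧ _) ↦ hx.2) hzV
  have hz1 := bicyclic_eq_one h h2 h1 hp (commutator_mono le_top le_top hzH) hzc hzV.2
  rw [hz1, orderOf_one] at hz
  exact hp.one_lt.ne hz

end Bicyclic

open Subgroup in
/-- If `gcd(m, φ(n)) = gcd(n, φ(m)) = 1` and a finite group `G` factorises as a
product of cyclic subgroups of orders `m` and `n`, then `G` is supersolvable. -/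
theorem singular_bicyclic_supersolvable (m n : ℕ) (hm : 0 < m) (hn : 0 < n)
    (h1 : Nat.gcd m (Nat.totient n) = 1) (h2 : Nat.gcd n (Nat.totient m) = 1)
    (G : Type*) [Group G] [Finite G] (a b : G)
    (ha : orderOf a = m) (hb : orderOf b = n)
    (hfact : ∀ g : G, ∃ i j : ℤ, g = a ^ i * b ^ j) :
    IsSupersolvable G := by
  subst ha hb
  have hab : Commute a b := bicyclic_commute_generators hfact h2 h1
  have hcen : ∀ g : G, Commute g a := fun g ↦ by
    obtain ⟨i, j, rfl⟩ := hfact g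
    exact ((Commute.refl a).zpow_left i).mul_left (hab.symm.zpow_left j)
  refine ⟨2, ![⊥, zpowers a, ⊤], rfl, rfl, ?_, ?_⟩
  · intro i
    fin_cases i
    · exact normal_bot
    · refine ⟨?_⟩
      rintro _ ⟨k, rfl⟩ g
      exact ⟨k, by rw [((hcen g).zpow_right k).eq, mul_inv_cancel_right]⟩
    · exact normal_top
  · intro i
    fin_cases i
    · refine ⟨bot_le, a, mem_zpowers a, ?_⟩
      rintro _ ⟨k, rfl⟩
      exact ⟨k, by simp⟩
    · refine ⟨le_top, b, mem_top b, fun g _ ↦ ?_⟩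
      obtain ⟨i, j, rfl⟩ := hfact g
      exact ⟨j, i, by simp⟩
end
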